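/- For every n ≥ 0, Σ_{λ ⊢ n} (f^λ)^2 = n!, where the sum is over all partitions λ of n and f^λ is the number of standard Young tableaux of shape λ. -/

import Mathlib

open Finset

/-- The Young diagram of a partition given by row lengths `f 1, f 2, …` (rows beyond `L` empty). -/
def cells (f : ℕ → ℕ) (L : ℕ) : Finset (ℕ × ℕ) :=
  (Finset.Icc 1 L ×ˢ Finset.Icc 1 (f 1)).filter fun p => p.2 ≤ f p.1

/-- The `j`-th column length (the conjugate partition). -/
def conj (f : ℕ → ℕ) (L j : ℕ) : ℕ :=
  ((Finset.Icc 1 L).filter fun i => j ≤ f i).card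

/-- Hook length of the square `(i,j)`. -/
def hook (f : ℕ → ℕ) (L i j : ℕ) : ℕ :=
  (f i - j) + (conj f L j - i) + 1

/-- Corners of the diagram: squares whose removal leaves a diagram. -/
def corners (f : ℕ → ℕ) (L : ℕ) : Finset (ℕ × ℕ) :=
  (cells f L).filter fun p => p.2 = f p.1 ∧ f (p.1 + 1) < p.2

/-- Outer corners: squares outside the diagram whose addition gives a diagram. -/
def outerCorners (f : ℕ → ℕ) (L : ℕ) : Finset (ℕ × ℕ) :=
  ((Finset.Icc 1 (L + 1)) ×ˢ (Finset.Icc 1 (f 1 + 1))).filter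
    fun p => p.2 = f p.1 + 1 ∧ (p.1 = 1 ∨ p.2 ≤ f (p.1 - 1))

/-- `f` encodes a partition: weakly decreasing rows, vanishing beyond `L`. -/
def IsPartitionFun (f : ℕ → ℕ) (L : ℕ) : Prop :=
  (∀ i, 1 ≤ i → f (i + 1) ≤ f i) ∧ (∀ i, L < i → f i = 0)

/-- The number of standard Young tableaux of the given shape. -/
noncomputable def sytCard (f : ℕ → ℕ) (L : ℕ) : ℕ :=
  Nat.card {T : ℕ × ℕ → ℕ //
    Set.BijOn T (cells f L) (Finset.Icc 1 (cells f L).card) ∧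
    (∀ p ∈ cells f L, ∀ q ∈ cells f L, p.1 ≤ q.1 → p.2 ≤ q.2 → p ≠ q → T p < T q) ∧
    ∀ p, p ∉ cells f L → T p = 0}

/-- Remove a cell from the end of row `r`. -/
def removeCell (f : ℕ → ℕ) (r : ℕ) : ℕ → ℕ := fun i => if i = r then f i - 1 else f i

/-- Add a cell at the end of row `r`. -/
def addCell (f : ℕ → ℕ) (r : ℕ) : ℕ → ℕ := fun i => if i = r then f i + 1 else f i

/-- The row lengths of a partition of `n` (weakly decreasing, indexed from `1`). -/
def rowFun {n : ℕ} (p : Nat.Partition n) : ℕ → ℕ :=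
  fun i => ((p.parts.sort (· ≤ ·)).reverse).getD (i - 1) 0

/-- One-indexed diagrams. -/
def Dg (s : Finset (ℕ × ℕ)) : Prop :=
  (∀ p ∈ s, 1 ≤ p.1 ∧ 1 ≤ p.2) ∧
    ∀ p ∈ s, ∀ q : ℕ × ℕ, 1 ≤ q.1 → 1 ≤ q.2 → q.1 ≤ p.1 → q.2 ≤ p.2 → q ∈ s

open Classical in
/-- Diagrams with `n` cells. -/
noncomputable def YY (n : ℕ) : Finset (Finset (ℕ × ℕ)) :=
  ((Finset.Icc 1 n ×ˢ Finset.Icc 1 n).powersetCard n).filter Dg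

/-- Diagrams with `n-1` cells. -/
noncomputable def ZZ : ℕ → Finset (Finset (ℕ × ℕ))
  | 0 => ∅
  | m + 1 => YY m

theorem mem_YY {n : ℕ} {s : Finset (ℕ × ℕ)} : s ∈ YY n ↔ Dg s ∧ s.card = n := by
  unfold YY
  simp only [mem_filter, mem_powersetCard]
  constructor
  · rintro ⟨⟨_, h⟩, h'⟩; exact ⟨h', h⟩
  · rintro ⟨h, hc⟩
    refine ⟨⟨?_, hc⟩, h⟩
    intro p hp
    have h1 := h.1 p hp
    have a1 : (Finset.Icc 1 p.1).card ≤ s.card := by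
      apply Finset.card_le_card_of_injOn (fun i => (i, p.2))
      · intro i hi
        simp only [coe_Icc, Set.mem_Icc] at hi
        exact h.2 p hp _ hi.1 h1.2 hi.2 le_rfl
      · intro a _ b _ hab
        simpa using hab
    have a2 : (Finset.Icc 1 p.2).card ≤ s.card := by
      apply Finset.card_le_card_of_injOn (fun i => (p.1, i))
      · intro i hi
        simp only [coe_Icc, Set.mem_Icc] at hi
        exact h.2 p hp _ h1.1 hi.1 le_rfl hi.2
      · intro a _ b _ hab
        simpa using hab
    simp only [Nat.card_Icc] at a1 a2
    simp only [mem_product, mem_Icc]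
    omega

theorem mem_ZZ {n : ℕ} {s : Finset (ℕ × ℕ)} : s ∈ ZZ n ↔ Dg s ∧ s.card + 1 = n := by
  cases n with
  | zero => simp [ZZ]
  | succ m => simp [ZZ, mem_YY]

theorem Dg.union {s t : Finset (ℕ × ℕ)} (hs : Dg s) (ht : Dg t) : Dg (s ∪ t) := by
  constructor
  · intro p hp
    rcases mem_union.1 hp with h | h
    · exact hs.1 p h
    · exact ht.1 p h
  · intro p hp q a b c d
    rcases mem_union.1 hp with h | h
    · exact mem_union_left _ (hs.2 p h q a b c d)
    · exact mem_union_right _ (ht.2 p h q a b c d)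

theorem Dg.inter {s t : Finset (ℕ × ℕ)} (hs : Dg s) (ht : Dg t) : Dg (s ∩ t) := by
  constructor
  · intro p hp
    exact hs.1 p (mem_inter.1 hp).1
  · intro p hp q a b c d
    have h := mem_inter.1 hp
    exact mem_inter.2 ⟨hs.2 p h.1 q a b c d, ht.2 p h.2 q a b c d⟩

theorem Dg.rows {s : Finset (ℕ × ℕ)} (hs : Dg s) : ∃ r : ℕ → ℕ,
    (∀ i, 1 ≤ i → r (i + 1) ≤ r i) ∧ ∀ i j, (i, j) ∈ s ↔ 1 ≤ i ∧ 1 ≤ j ∧ j ≤ r i := by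
  have hex : ∀ i, ∃ j, (i, j + 1) ∉ s := by
    intro i
    by_contra! hcon
    have := Finset.card_le_card_of_injOn (s := Finset.range (s.card + 1)) (t := s)
      (fun j => (i, j + 1)) (fun j _ => hcon j) (by
        intro a _ b _ hab
        simpa using hab)
    simp at this
  have key : ∀ i j, (i, j) ∈ s ↔ 1 ≤ i ∧ 1 ≤ j ∧ j ≤ Nat.find (hex i) := by
    intro i j
    constructor
    · intro h
      have h1 := hs.1 _ h
      refine ⟨h1.1, h1.2, ?_⟩
      by_contra! hlt
      exact Nat.find_spec (hex i) (hs.2 _ h _ h1.1 (by simp) le_rfl hlt)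
    · rintro ⟨h1, h2, h3⟩
      have := Nat.find_min (hex i) (m := j - 1) (by omega)
      rw [Nat.sub_add_cancel h2] at this
      exact not_not.1 this
  refine ⟨fun i => Nat.find (hex i), ?_, key⟩
  intro i hi
  show Nat.find (hex (i+1)) ≤ Nat.find (hex i)
  rcases Nat.eq_zero_or_pos (Nat.find (hex (i+1))) with h | h
  · rw [h]; exact Nat.zero_le _
  · have := (key (i+1) (Nat.find (hex (i+1)))).2 ⟨by omega, h, le_rfl⟩
    exact ((key _ _).1 (hs.2 _ this (i, Nat.find (hex (i+1))) hi h (by simp) le_rfl)).2.2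

theorem YY_box {n : ℕ} {s : Finset (ℕ × ℕ)} (hs : s ∈ YY n) {i j : ℕ} (h : (i, j) ∈ s) : i ≤ n := by
  classical
  unfold YY at hs
  have := (mem_filter.1 hs).1
  have := (mem_powersetCard.1 this).1 h
  simp only [mem_product, mem_Icc] at this
  omega

set_option maxHeartbeats 2000000 in
open Classical in
theorem up_down_self {n : ℕ} {s : Finset (ℕ × ℕ)} (hs : s ∈ YY n) :
    ((YY (n+1)).filter (fun ν => s ⊆ ν)).card = ((ZZ n).filter (fun κ => κ ⊆ s)).card + 1 := by
  obtain ⟨hd, hc⟩ := mem_YY.1 hs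
  obtain ⟨r, hr, hm⟩ := hd.rows
  have hr0 : ∀ i, n < i → r i = 0 := by
    intro i hi
    by_contra hne
    have h1 : (i, 1) ∈ s := (hm _ _).2 ⟨by omega, le_rfl, by omega⟩
    have := YY_box hs h1
    omega
  have anti : ∀ i j, 1 ≤ i → i ≤ j → r j ≤ r i := by
    intro i j hi hij
    induction j, hij using Nat.le_induction with
    | base => exact le_rfl
    | succ k hk ih => exact (hr k (by omega)).trans ih
  let B := (Finset.Icc 1 n).filter (fun i => r (i+1) < r i)
  have hdown : (ZZ n).filter (fun κ => κ ⊆ s) = B.image (fun i => s.erase (i, r i)) := by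
    ext κ
    simp only [mem_filter, mem_ZZ, mem_image, B, mem_Icc]
    constructor
    · rintro ⟨⟨hk, hkc⟩, hsub⟩
      have h1 : (s \ κ).card = 1 := by
        rw [card_sdiff_of_subset hsub]; omega
      obtain ⟨⟨a, b⟩, hab⟩ := card_eq_one.1 h1
      have hmem : ∀ p, p ∈ s ∧ p ∉ κ ↔ p = (a, b) := by
        intro p; rw [← mem_sdiff, hab, mem_singleton]
      have hab1 := (hmem (a, b)).2 rfl
      have hab2 := (hm _ _).1 hab1.1
      have hb : b = r a := by
        by_contra hne
        have h2 : (a, b+1) ∈ s := (hm _ _).2 ⟨hab2.1, by omega, by omega⟩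
        have h3 : (a, b+1) ∈ κ := by
          by_contra h3
          have := (hmem _).1 ⟨h2, h3⟩
          simp at this
        exact hab1.2 (hk.2 _ h3 _ hab2.1 hab2.2.1 le_rfl (by simp))
      refine ⟨a, ⟨⟨hab2.1, ?_⟩, ?_⟩, ?_⟩
      · by_contra hlt
        have := hr0 a (by omega)
        omega
      · by_contra hlt
        have h2 : (a+1, b) ∈ s := (hm _ _).2 ⟨by omega, by omega, by omega⟩
        have h3 : (a+1, b) ∈ κ := by
          by_contra h3
          have := (hmem _).1 ⟨h2, h3⟩
          simp at this
        exact hab1.2 (hk.2 _ h3 _ hab2.1 hab2.2.1 (by simp) le_rfl)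
      · rw [← hb]
        ext p
        have := hmem p
        have := @hsub p
        rw [mem_erase]
        tauto
    · rintro ⟨a, ⟨⟨h1, h2⟩, h3⟩, rfl⟩
      have ha : (a, r a) ∈ s := (hm _ _).2 ⟨h1, by omega, le_rfl⟩
      refine ⟨⟨⟨?_, ?_⟩, ?_⟩, erase_subset _ _⟩
      · intro p hp
        exact hd.1 p (mem_of_mem_erase hp)
      · rintro ⟨p1, p2⟩ hp ⟨q1, q2⟩ e1 e2 e3 e4
        rw [mem_erase] at hp ⊢
        refine ⟨?_, hd.2 _ hp.2 _ e1 e2 e3 e4⟩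
        intro heq
        simp only [Prod.mk.injEq, ne_eq] at heq hp e1 e2 e3 e4
        obtain ⟨rfl, rfl⟩ := heq
        have := (hm _ _).1 hp.2
        rcases Nat.lt_or_ge q1 p1 with h | h
        · have := anti (q1+1) p1 (by omega) (by omega)
          omega
        · have : p1 = q1 := by omega
          subst this
          omega
      · have := card_pos.2 ⟨_, ha⟩
        rw [card_erase_of_mem ha]; omega
  let A := (Finset.Icc 1 (n+1)).filter (fun i => i = 1 ∨ r i < r (i-1))
  have hup : (YY (n+1)).filter (fun ν => s ⊆ ν) = A.image (fun i => insert (i, r i + 1) s) := by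
    ext ν
    simp only [mem_filter, mem_YY, mem_image, A, mem_Icc]
    constructor
    · rintro ⟨⟨hk, hkc⟩, hsub⟩
      have h1 : (ν \ s).card = 1 := by
        rw [card_sdiff_of_subset hsub]; omega
      obtain ⟨⟨a, b⟩, hab⟩ := card_eq_one.1 h1
      have hmem : ∀ p, p ∈ ν ∧ p ∉ s ↔ p = (a, b) := by
        intro p; rw [← mem_sdiff, hab, mem_singleton]
      have hab1 := (hmem (a, b)).2 rfl
      have hab0 := hk.1 _ hab1.1
      simp only at hab0
      have hab2 := hab1.2
      rw [hm] at hab2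
      have hb : b = r a + 1 := by
        by_contra hne
        have h2 : (a, b-1) ∈ ν := hk.2 _ hab1.1 _ hab0.1 (by simp only; omega) le_rfl (by simp)
        have h3 : (a, b-1) ∈ s := by
          by_contra h3
          have := (hmem _).1 ⟨h2, h3⟩
          simp at this
          omega
        rw [hm] at h3
        omega
      have hor : a = 1 ∨ r a < r (a-1) := by
        by_contra! hcon
        have h2 : (a-1, b) ∈ ν := hk.2 _ hab1.1 _ (by simp only; omega) hab0.2 (by simp) le_rfl
        have h3 : (a-1, b) ∈ s := by
          by_contra h3
          have := (hmem _).1 ⟨h2, h3⟩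
          simp at this
          omega
        rw [hm] at h3
        omega
      refine ⟨a, ⟨⟨hab0.1, ?_⟩, hor⟩, ?_⟩
      · by_contra hlt
        have := hr0 (a-1) (by omega)
        omega
      · rw [← hb]
        ext p
        have := hmem p
        have := @hsub p
        rw [mem_insert]
        tauto
    · rintro ⟨a, ⟨⟨h1, h2⟩, h3⟩, rfl⟩
      have ha : (a, r a + 1) ∉ s := by rw [hm]; omega
      refine ⟨⟨⟨?_, ?_⟩, ?_⟩, subset_insert _ _⟩
      · intro p hp
        rcases mem_insert.1 hp with rfl | hp
        · exact ⟨h1, by simp⟩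
        · exact hd.1 p hp
      · rintro ⟨p1, p2⟩ hp ⟨q1, q2⟩ e1 e2 e3 e4
        rw [mem_insert] at hp ⊢
        simp only at e1 e2 e3 e4
        rcases hp with heq | hp
        · simp only [Prod.mk.injEq] at heq
          obtain ⟨rfl, rfl⟩ := heq
          rw [hm, Prod.mk.injEq]
          rcases Nat.lt_or_ge q1 p1 with h | h
          · have := anti q1 (p1-1) (by omega) (by omega)
            omega
          · have : p1 = q1 := by omega
            subst this
            omega
        · exact Or.inr (hd.2 _ hp _ e1 e2 e3 e4)
      · rw [card_insert_of_notMem ha, hc]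
  have hAB : A = insert 1 (B.image (fun i => i + 1)) := by
    ext i
    simp only [A, B, mem_filter, mem_Icc, mem_insert, mem_image]
    constructor
    · rintro ⟨h1, h2⟩
      by_cases h : i = 1
      · exact Or.inl h
      · refine Or.inr ⟨i - 1, ⟨by omega, ?_⟩, by omega⟩
        rw [Nat.sub_add_cancel h1.1]
        tauto
    · rintro (rfl | ⟨a, ⟨h1, h2⟩, rfl⟩)
      · exact ⟨by omega, Or.inl rfl⟩
      · exact ⟨by omega, Or.inr (by simpa using h2)⟩
  rw [hdown, hup, card_image_of_injOn, card_image_of_injOn, hAB, card_insert_of_notMem,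
    card_image_of_injective]
  · exact add_left_injective 1
  · simp [B]
  · intro i hi j hj hij
    simp only [B, coe_filter, Set.mem_ofPred_eq, mem_Icc] at hi hj
    by_contra hne
    have h1 : (i, r i) ∈ s := (hm _ _).2 ⟨by omega, by omega, le_rfl⟩
    have h2 : (i, r i) ∈ s.erase (j, r j) := mem_erase.2 ⟨by simp [hne], h1⟩
    simp only at hij
    rw [← hij] at h2
    simp at h2
  · intro i hi j hj hij
    by_contra hne
    have h2 : (i, r i + 1) ∈ insert (j, r j + 1) s := by
      simp only at hij
      rw [← hij]; simp
    rw [mem_insert, hm] at h2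
    rcases h2 with h2 | h2
    · simp [hne] at h2
    · omega

open Classical in
theorem up_down {n : ℕ} {s t : Finset (ℕ × ℕ)} (hs : s ∈ YY n) (ht : t ∈ YY n) :
    ((YY (n+1)).filter (fun ν => s ⊆ ν ∧ t ⊆ ν)).card =
      ((ZZ n).filter (fun κ => κ ⊆ s ∧ κ ⊆ t)).card + if s = t then 1 else 0 := by
  by_cases hst : s = t
  · subst hst
    simpa using up_down_self hs
  rw [if_neg hst]
  obtain ⟨hd, hc⟩ := mem_YY.1 hs
  obtain ⟨hd', hc'⟩ := mem_YY.1 ht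
  have hcard := card_union_add_card_inter s t
  have hlt : n < (s ∪ t).card := by
    rw [← hc]
    apply card_lt_card
    refine Finset.ssubset_iff_subset_ne.2 ⟨subset_union_left, ?_⟩
    intro h
    have : t ⊆ s := by rw [h]; exact subset_union_right
    exact hst (eq_of_subset_of_card_le this (by omega)).symm
  by_cases hu : (s ∪ t).card = n + 1
  · have e1 : (YY (n+1)).filter (fun ν => s ⊆ ν ∧ t ⊆ ν) = {s ∪ t} := by
      ext ν
      simp only [mem_filter, mem_YY, mem_singleton]
      constructor
      · rintro ⟨⟨_, h1⟩, h2, h3⟩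
        exact (eq_of_subset_of_card_le (union_subset h2 h3) (by omega)).symm
      · rintro rfl
        exact ⟨⟨hd.union hd', hu⟩, subset_union_left, subset_union_right⟩
    have e2 : (ZZ n).filter (fun κ => κ ⊆ s ∧ κ ⊆ t) = {s ∩ t} := by
      ext ν
      simp only [mem_filter, mem_ZZ, mem_singleton]
      constructor
      · rintro ⟨⟨_, h1⟩, h2, h3⟩
        exact (eq_of_subset_of_card_le (subset_inter h2 h3) (by omega))
      · rintro rfl
        exact ⟨⟨hd.inter hd', by omega⟩, inter_subset_left, inter_subset_right⟩
    rw [e1, e2]; simp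
  · have e1 : (YY (n+1)).filter (fun ν => s ⊆ ν ∧ t ⊆ ν) = ∅ := by
      apply filter_eq_empty_iff.2
      rintro ν hν ⟨h2, h3⟩
      have := card_le_card (union_subset h2 h3)
      have := (mem_YY.1 hν).2
      omega
    have e2 : (ZZ n).filter (fun κ => κ ⊆ s ∧ κ ⊆ t) = ∅ := by
      apply filter_eq_empty_iff.2
      rintro ν hν ⟨h2, h3⟩
      have := card_le_card (subset_inter h2 h3)
      have := (mem_ZZ.1 hν).2
      omega
    rw [e1, e2]; simp

theorem swap_sum {α β : Type*} (X : Finset α) (Y : Finset β) (f : β → ℕ) (P : α → Prop)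
    (Q : α → β → Prop) [DecidablePred P] [∀ ν, DecidablePred (Q ν)]
    [∀ t, DecidablePred (fun ν => P ν ∧ Q ν t)] :
    ∑ ν ∈ X.filter P, ∑ t ∈ Y.filter (Q ν), f t =
      ∑ t ∈ Y, (X.filter (fun ν => P ν ∧ Q ν t)).card * f t := by
  rw [sum_comm' (t' := Y) (s' := fun t => X.filter (fun ν => P ν ∧ Q ν t))
    (by intro x y; simp only [mem_filter]; tauto)]
  simp only [sum_const, smul_eq_mul]

open Classical in
theorem up_sum (f : Finset (ℕ × ℕ) → ℕ)
    (hf : ∀ n, ∀ s ∈ YY (n+1), f s = ∑ t ∈ (YY n).filter (fun t => t ⊆ s), f t) (n : ℕ) :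
    ∀ s ∈ YY n, ∑ ν ∈ (YY (n+1)).filter (fun ν => s ⊆ ν), f ν = (n + 1) * f s := by
  induction n with
  | zero =>
    intro s hs
    have hc : ∀ t ∈ YY 0, t = s := by
      intro t ht
      rw [card_eq_zero.1 (mem_YY.1 hs).2, card_eq_zero.1 (mem_YY.1 ht).2]
    have h1 := up_down_self hs
    simp only [ZZ, filter_empty, card_empty, zero_add] at h1
    obtain ⟨ν, hν⟩ := card_eq_one.1 h1
    have hmem : ν ∈ (YY (0+1)).filter (fun ν => s ⊆ ν) := by rw [hν]; simp
    rw [hν, sum_singleton, hf 0 ν (mem_filter.1 hmem).1]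
    have : (YY 0).filter (fun t => t ⊆ ν) = {s} := by
      ext t
      simp only [mem_filter, mem_singleton]
      constructor
      · intro h; exact hc t h.1
      · rintro rfl; exact ⟨hs, (mem_filter.1 hmem).2⟩
    rw [this]; simp
  | succ n ih =>
    intro s hs
    calc ∑ ν ∈ (YY (n+1+1)).filter (fun ν => s ⊆ ν), f ν
        = ∑ ν ∈ (YY (n+1+1)).filter (fun ν => s ⊆ ν), ∑ t ∈ (YY (n+1)).filter (fun t => t ⊆ ν), f t :=
          sum_congr rfl fun ν hν => hf _ ν (mem_filter.1 hν).1
      _ = ∑ t ∈ YY (n+1), ((YY (n+1+1)).filter (fun ν => s ⊆ ν ∧ t ⊆ ν)).card * f t :=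
          swap_sum (YY (n+1+1)) (YY (n+1)) f (fun ν => s ⊆ ν) (fun ν t => t ⊆ ν)
      _ = ∑ t ∈ YY (n+1), (((YY n).filter (fun κ => κ ⊆ s ∧ κ ⊆ t)).card * f t +
            if s = t then f t else 0) := by
          refine sum_congr rfl fun t ht => ?_
          rw [up_down hs ht, add_mul]
          congr 1
          split_ifs <;> simp
      _ = ∑ κ ∈ (YY n).filter (fun κ => κ ⊆ s), ∑ t ∈ (YY (n+1)).filter (fun t => κ ⊆ t), f t + f s := by
          rw [sum_add_distrib, sum_ite_eq, if_pos hs,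
            swap_sum (YY n) (YY (n+1)) f (fun κ => κ ⊆ s) (fun κ t => κ ⊆ t)]
      _ = ∑ κ ∈ (YY n).filter (fun κ => κ ⊆ s), (n + 1) * f κ + f s := by
          congr 1
          exact sum_congr rfl fun κ hκ => ih κ (mem_filter.1 hκ).1
      _ = (n + 1 + 1) * f s := by
          rw [← mul_sum, ← hf n s hs]; ring

open Classical in
theorem sq_sum (f : Finset (ℕ × ℕ) → ℕ) (h0 : f ∅ = 1)
    (hf : ∀ n, ∀ s ∈ YY (n+1), f s = ∑ t ∈ (YY n).filter (fun t => t ⊆ s), f t) (n : ℕ) :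
    ∑ s ∈ YY n, f s ^ 2 = n.factorial := by
  induction n with
  | zero =>
    have : YY 0 = {∅} := by
      ext s
      rw [mem_YY, mem_singleton, card_eq_zero]
      constructor
      · exact fun h => h.2
      · rintro rfl; exact ⟨by simp [Dg], rfl⟩
    simp [this, h0]
  | succ n ih =>
    calc ∑ s ∈ YY (n+1), f s ^ 2
        = ∑ s ∈ YY (n+1), ∑ t ∈ (YY n).filter (fun t => t ⊆ s), f t * f s := by
          refine sum_congr rfl fun s hs => ?_
          rw [← sum_mul, ← hf n s hs, sq]
      _ = ∑ t ∈ YY n, ∑ s ∈ (YY (n+1)).filter (fun s => t ⊆ s), f t * f s := by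
          apply sum_comm'
          simp only [mem_filter]; tauto
      _ = ∑ t ∈ YY n, (n+1) * f t ^ 2 := by
          refine sum_congr rfl fun t ht => ?_
          rw [← mul_sum, up_sum f hf n t ht]; ring
      _ = _ := by
          rw [← mul_sum, ih, Nat.factorial_succ]

/-- Standard fillings of a finite set of cells. -/
def IsSyt (s : Finset (ℕ × ℕ)) (T : ℕ × ℕ → ℕ) : Prop :=
    Set.BijOn T s (Finset.Icc 1 s.card) ∧
    (∀ p ∈ s, ∀ q ∈ s, p.1 ≤ q.1 → p.2 ≤ q.2 → p ≠ q → T p < T q) ∧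
    ∀ p, p ∉ s → T p = 0

/-- Number of standard fillings. -/
noncomputable def numSyt (s : Finset (ℕ × ℕ)) : ℕ := Nat.card {T : ℕ × ℕ → ℕ // IsSyt s T}

theorem IsSyt.le {s : Finset (ℕ × ℕ)} {T : ℕ × ℕ → ℕ} (h : IsSyt s T) {p : ℕ × ℕ} (hp : p ∈ s) :
    1 ≤ T p ∧ T p ≤ s.card := by
  have := h.1.mapsTo (mem_coe.2 hp)
  simpa using this

instance finite_syt (s : Finset (ℕ × ℕ)) : Finite {T : ℕ × ℕ → ℕ // IsSyt s T} := by
  apply Finite.of_injective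
    (fun T : {T : ℕ × ℕ → ℕ // IsSyt s T} => fun p : s =>
      (⟨T.1 p.1, Nat.lt_succ_of_le (T.2.le p.2).2⟩ : Fin (s.card + 1)))
  intro T T' h
  apply Subtype.ext
  funext p
  by_cases hp : p ∈ s
  · have := congrFun h ⟨p, hp⟩
    simpa using this
  · rw [T.2.2.2 p hp, T'.2.2.2 p hp]

theorem numSyt_empty : numSyt ∅ = 1 := by
  unfold numSyt
  rw [Nat.card_eq_one_iff_unique]
  refine ⟨⟨fun T T' => ?_⟩, ⟨⟨fun _ => 0, ?_⟩⟩⟩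
  · apply Subtype.ext
    funext p
    rw [T.2.2.2 p (by simp), T'.2.2.2 p (by simp)]
  · simp [IsSyt]

open Classical in
theorem numSyt_rec (n : ℕ) (s : Finset (ℕ × ℕ)) (hs : s ∈ YY (n+1)) :
    numSyt s = ∑ t ∈ (YY n).filter (fun t => t ⊆ s), numSyt t := by
  obtain ⟨hd, hc⟩ := mem_YY.1 hs
  rw [← Finset.sum_coe_sort]
  unfold numSyt
  rw [← Nat.card_sigma]
  symm
  have hprop : ∀ t ∈ (YY n).filter (fun t => t ⊆ s), ∀ T, IsSyt t T →
      IsSyt s (fun p => if p ∈ t then T p else if p ∈ s then n + 1 else 0) := by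
    intro t ht T hT
    simp only [mem_filter, mem_YY] at ht
    obtain ⟨⟨htd, htc⟩, hts⟩ := ht
    have h1 : (s \ t).card = 1 := by
      rw [card_sdiff_of_subset hts]; omega
    obtain ⟨c, hab⟩ := card_eq_one.1 h1
    have hmem : ∀ p, p ∈ s ∧ p ∉ t ↔ p = c := by
      intro p; rw [← mem_sdiff, hab, mem_singleton]
    have hle := fun p (hp : p ∈ t) => hT.le hp
    rw [htc] at hle
    refine ⟨⟨?_, ?_, ?_⟩, ?_, ?_⟩
    · intro p hp
      have hp' : p ∈ s := hp
      simp only [coe_Icc, Set.mem_Icc, hc]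
      split_ifs with h
      · have := hle p h; omega
      · omega
    · intro p hp q hq hpq
      have hp' : p ∈ s := hp
      have hq' : q ∈ s := hq
      simp only [hp', hq', if_true] at hpq
      split_ifs at hpq with h h' h'
      · exact hT.1.injOn h h' hpq
      · have := hle p h; omega
      · have := hle q h'; omega
      · rw [(hmem p).1 ⟨hp', h⟩, (hmem q).1 ⟨hq', h'⟩]
    · intro k hk
      simp only [coe_Icc, Set.mem_Icc, hc] at hk
      by_cases hkn : k = n + 1
      · have := (hmem c).2 rfl
        exact ⟨c, this.1, by simp [this, hkn]⟩
      · obtain ⟨p, hp, hpk⟩ := hT.1.surjOn (show k ∈ _ by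
          simp only [coe_Icc, Set.mem_Icc, htc]; omega)
        have hp' : p ∈ t := hp
        exact ⟨p, hts hp', by simp [hp', hpk]⟩
    · intro p hp q hq h1 h2 hne
      simp only [hp, hq, if_true]
      split_ifs with h h' h'
      · exact hT.2.1 p h q h' h1 h2 hne
      · have := hle p h; omega
      · exact absurd (htd.2 q h' p (hd.1 p hp).1 (hd.1 p hp).2 h1 h2) h
      · exact absurd (((hmem p).1 ⟨hp, h⟩).trans ((hmem q).1 ⟨hq, h'⟩).symm) hne
    · intro p hp
      have : p ∉ t := fun h => hp (hts h)
      simp [hp, this]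
  refine Nat.card_congr (Equiv.ofBijective
    (fun x : Σ t : {t // t ∈ (YY n).filter (fun t => t ⊆ s)}, {T : ℕ × ℕ → ℕ // IsSyt t.1 T} =>
      (⟨_, hprop x.1.1 x.1.2 x.2.1 x.2.2⟩ : {T : ℕ × ℕ → ℕ // IsSyt s T})) ⟨?_, ?_⟩)
  · rintro ⟨⟨t, ht⟩, ⟨T, hT⟩⟩ ⟨⟨t', ht'⟩, ⟨T', hT'⟩⟩ heq
    simp only [Subtype.mk.injEq] at heq
    have hle := fun p (hp : p ∈ t) => hT.le hp
    have hle' := fun p (hp : p ∈ t') => hT'.le hp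
    have a := mem_filter.1 ht
    have a' := mem_filter.1 ht'
    rw [(mem_YY.1 a.1).2] at hle
    rw [(mem_YY.1 a'.1).2] at hle'
    have htt : t = t' := by
      ext p
      have := congrFun heq p
      constructor
      · intro hp
        by_contra hp'
        have := hle p hp
        simp only [hp, hp', a.2 hp, if_true, if_false] at *
        omega
      · intro hp
        by_contra hp'
        have := hle' p hp
        simp only [hp, hp', a'.2 hp, if_true, if_false] at *
        omega
    subst htt
    have hTT : T = T' := by
      funext p
      by_cases hp : p ∈ t
      · have := congrFun heq p
        simpa [hp] using this
      · rw [hT.2.2 p hp, hT'.2.2 p hp]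
    subst hTT
    rfl
  · rintro ⟨T, hT⟩
    have hle := fun p (hp : p ∈ s) => hT.le hp
    rw [hc] at hle
    have hbij : Set.BijOn T (s.filter (fun p => T p ≤ n)) (Finset.Icc 1 n) := by
      refine ⟨?_, ?_, ?_⟩
      · intro p hp
        simp only [coe_filter, Set.mem_ofPred_eq] at hp
        simp only [coe_Icc, Set.mem_Icc]
        exact ⟨(hle p hp.1).1, hp.2⟩
      · exact hT.1.injOn.mono (fun p hp => (mem_filter.1 hp).1)
      · intro k hk
        simp only [coe_Icc, Set.mem_Icc] at hk
        obtain ⟨p, hp, hpk⟩ := hT.1.surjOn (show k ∈ _ by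
          simp only [coe_Icc, Set.mem_Icc, hc]; omega)
        refine ⟨p, ?_, hpk⟩
        simp only [coe_filter, Set.mem_ofPred_eq]
        exact ⟨hp, by omega⟩
    have hcard : (s.filter (fun p => T p ≤ n)).card = n := by
      have := Finset.card_nbij T (fun p hp => hbij.mapsTo hp) hbij.injOn hbij.surjOn
      simpa using this
    have ht : s.filter (fun p => T p ≤ n) ∈ (YY n).filter (fun t => t ⊆ s) := by
      rw [mem_filter, mem_YY]
      refine ⟨⟨⟨?_, ?_⟩, hcard⟩, filter_subset _ _⟩
      · intro p hp
        exact hd.1 p (mem_filter.1 hp).1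
      · intro p hp q e1 e2 e3 e4
        rw [mem_filter] at hp ⊢
        have hq := hd.2 p hp.1 q e1 e2 e3 e4
        refine ⟨hq, ?_⟩
        by_cases hne : q = p
        · rw [hne]; exact hp.2
        · exact (hT.2.1 q hq p hp.1 e3 e4 hne).le.trans hp.2
    refine ⟨⟨⟨_, ht⟩, ⟨fun p => if p ∈ s.filter (fun p => T p ≤ n) then T p else 0, ?_, ?_, ?_⟩⟩, ?_⟩
    · simp only [hcard]
      refine hbij.congr ?_
      intro p hp
      have hp' : p ∈ s.filter (fun p => T p ≤ n) := hp
      simp only [hp', if_true]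
    · intro p hp q hq e1 e2 hne
      simp only at hp hq
      simp only [hp, hq, if_true]
      exact hT.2.1 p (mem_filter.1 hp).1 q (mem_filter.1 hq).1 e1 e2 hne
    · intro p hp
      simp only at hp
      simp only [hp, if_false]
    · apply Subtype.ext
      funext p
      simp only [mem_filter]
      by_cases hp : p ∈ s
      · have := hle p hp
        by_cases h : T p ≤ n
        · simp [hp, h]
        · simp [hp, h]; omega
      · simp [hp, hT.2.2 p hp]

theorem card_rows {s : Finset (ℕ × ℕ)} {r : ℕ → ℕ} {n : ℕ}
    (hm : ∀ i j, (i, j) ∈ s ↔ 1 ≤ i ∧ 1 ≤ j ∧ j ≤ r i) (h0 : ∀ i, n < i → r i = 0) :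
    s.card = ∑ i ∈ range n, r (i + 1) := by
  have : s = (range n).biUnion (fun i => {i + 1} ×ˢ Finset.Icc 1 (r (i + 1))) := by
    ext ⟨a, b⟩
    simp only [hm, mem_biUnion, mem_product, mem_singleton, mem_range, mem_Icc]
    constructor
    · rintro ⟨h1, h2, h3⟩
      refine ⟨a - 1, ?_, by omega, h2, ?_⟩
      · by_contra hlt
        have := h0 a (by omega)
        omega
      · rwa [Nat.sub_add_cancel h1]
    · rintro ⟨i, h1, rfl, h2, h3⟩
      exact ⟨by omega, h2, h3⟩
  rw [this, card_biUnion]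
  · simp
  · intro i _ j _ hij
    simp only [Function.onFun]
    rw [Finset.disjoint_left]
    rintro ⟨a, b⟩ h h'
    simp only [mem_product, mem_singleton] at h h'
    omega

theorem sum_getD (l : List ℕ) : ∀ n, l.length ≤ n → ∑ i ∈ range n, l.getD i 0 = l.sum := by
  induction l with
  | nil => intro n _; simp
  | cons a l ih =>
    intro n hn
    obtain ⟨m, rfl⟩ : ∃ m, n = m + 1 := ⟨n - 1, by simp at hn; omega⟩
    rw [sum_range_succ']
    simp only [List.getD_cons_succ, List.getD_cons_zero, List.sum_cons]
    rw [ih m (by simpa using hn)]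
    ring

/-- Row lengths as a list. -/
def rowList {n : ℕ} (p : Nat.Partition n) : List ℕ := (p.parts.sort (· ≤ ·)).reverse

theorem rowList_coe {n : ℕ} (p : Nat.Partition n) : (rowList p : Multiset ℕ) = p.parts := by
  unfold rowList
  rw [Multiset.coe_reverse, Multiset.sort_eq]

theorem rowList_pos {n : ℕ} (p : Nat.Partition n) : ∀ x ∈ rowList p, 0 < x := by
  intro x hx
  apply p.parts_pos
  rw [← rowList_coe]; exact hx

theorem rowList_sum {n : ℕ} (p : Nat.Partition n) : (rowList p).sum = n := by
  rw [← Multiset.sum_coe, rowList_coe, p.parts_sum]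

theorem rowList_length {n : ℕ} (p : Nat.Partition n) : (rowList p).length ≤ n := by
  have := List.length_le_sum_of_one_le (rowList p) (rowList_pos p)
  rwa [rowList_sum] at this

theorem rowList_sorted {n : ℕ} (p : Nat.Partition n) : (rowList p).Pairwise (· ≥ ·) := by
  unfold rowList
  rw [List.pairwise_reverse]
  exact Multiset.pairwise_sort _ _

theorem rowFun_eq {n : ℕ} (p : Nat.Partition n) (i : ℕ) : rowFun p i = (rowList p).getD (i-1) 0 := rfl

theorem rowFun_zero {n : ℕ} (p : Nat.Partition n) (i : ℕ) (h : n < i) : rowFun p i = 0 := by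
  rw [rowFun_eq, List.getD_eq_default]
  have := rowList_length p
  omega

theorem rowFun_anti {n : ℕ} (p : Nat.Partition n) {i j : ℕ} (h : i ≤ j) :
    rowFun p j ≤ rowFun p i := by
  rw [rowFun_eq, rowFun_eq]
  rcases Nat.lt_or_ge (j - 1) (rowList p).length with hj | hj
  · have hi : i - 1 < (rowList p).length := by omega
    rw [List.getD_eq_getElem _ _ hj, List.getD_eq_getElem _ _ hi]
    rcases Nat.eq_or_lt_of_le (show i - 1 ≤ j - 1 by omega) with h' | h'
    · simp [h']
    · exact List.pairwise_iff_getElem.1 (rowList_sorted p) _ _ hi hj h'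
  · rw [List.getD_eq_default _ _ hj]; exact Nat.zero_le _

theorem mem_cells_rowFun {n : ℕ} (p : Nat.Partition n) (i j : ℕ) :
    (i, j) ∈ cells (rowFun p) n ↔ 1 ≤ i ∧ 1 ≤ j ∧ j ≤ rowFun p i := by
  simp only [cells, mem_filter, mem_product, mem_Icc]
  constructor
  · tauto
  · rintro ⟨h1, h2, h3⟩
    refine ⟨⟨⟨h1, ?_⟩, h2, h3.trans (rowFun_anti p h1)⟩, h3⟩
    by_contra h
    have := rowFun_zero p i (by omega)
    omega

theorem cells_mem_YY {n : ℕ} (p : Nat.Partition n) : cells (rowFun p) n ∈ YY n := by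
  rw [mem_YY]
  refine ⟨⟨?_, ?_⟩, ?_⟩
  · rintro ⟨i, j⟩ h
    rw [mem_cells_rowFun] at h
    exact ⟨h.1, h.2.1⟩
  · rintro ⟨i, j⟩ h ⟨a, b⟩ h1 h2 h3 h4
    rw [mem_cells_rowFun] at h ⊢
    exact ⟨h1, h2, h4.trans (h.2.2.trans (rowFun_anti p h3))⟩
  · rw [card_rows (mem_cells_rowFun p) (rowFun_zero p)]
    simp only [rowFun_eq, Nat.add_sub_cancel]
    rw [sum_getD _ _ (rowList_length p), rowList_sum]

theorem getElem?_of_pos (l : List ℕ) (h : ∀ x ∈ l, 0 < x) (i : ℕ) :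
    l[i]? = if l.getD i 0 = 0 then none else some (l.getD i 0) := by
  rcases Nat.lt_or_ge i l.length with hi | hi
  · have := h _ (List.getElem_mem hi)
    rw [List.getD_eq_getElem _ _ hi, List.getElem?_eq_getElem hi, if_neg (by omega)]
  · rw [List.getD_eq_default _ _ hi, List.getElem?_eq_none hi, if_pos rfl]

theorem rowFun_ext {s : Finset (ℕ × ℕ)} {r r' : ℕ → ℕ}
    (hm : ∀ i j, (i, j) ∈ s ↔ 1 ≤ i ∧ 1 ≤ j ∧ j ≤ r i)
    (hm' : ∀ i j, (i, j) ∈ s ↔ 1 ≤ i ∧ 1 ≤ j ∧ j ≤ r' i) (i : ℕ) (hi : 1 ≤ i) : r i = r' i := by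
  have h1 := (hm i (r i)).symm.trans (hm' i (r i))
  have h2 := (hm i (r' i)).symm.trans (hm' i (r' i))
  omega

theorem cells_inj {n : ℕ} (p q : Nat.Partition n)
    (h : cells (rowFun p) n = cells (rowFun q) n) : p = q := by
  have hr : ∀ i, 1 ≤ i → rowFun p i = rowFun q i :=
    rowFun_ext (mem_cells_rowFun p) (by rw [h]; exact mem_cells_rowFun q)
  have hl : rowList p = rowList q := by
    apply List.ext_getElem?
    intro i
    have := hr (i + 1) (by omega)
    simp only [rowFun_eq, Nat.add_sub_cancel] at this
    rw [getElem?_of_pos _ (rowList_pos p), getElem?_of_pos _ (rowList_pos q), this]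
  apply Nat.Partition.ext
  rw [← rowList_coe, ← rowList_coe, hl]

theorem cells_surj {n : ℕ} (s : Finset (ℕ × ℕ)) (hs : s ∈ YY n) :
    ∃ p : Nat.Partition n, cells (rowFun p) n = s := by
  obtain ⟨hd, hc⟩ := mem_YY.1 hs
  obtain ⟨r, hr, hm⟩ := hd.rows
  have hr0 : ∀ i, n < i → r i = 0 := by
    intro i hi
    by_contra hne
    have h1 : (i, 1) ∈ s := (hm _ _).2 ⟨by omega, le_rfl, by omega⟩
    have := YY_box hs h1
    omega
  have anti : ∀ i j, 1 ≤ i → i ≤ j → r j ≤ r i := by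
    intro i j hi hij
    induction j, hij using Nat.le_induction with
    | base => exact le_rfl
    | succ k hk ih => exact (hr k (by omega)).trans ih
  have hex : ∃ k, r (k + 1) = 0 := ⟨n, hr0 _ (by omega)⟩
  obtain ⟨k, hk, hkn, hkmin⟩ : ∃ k, r (k + 1) = 0 ∧ k ≤ n ∧ ∀ i < k, 0 < r (i + 1) :=
    ⟨Nat.find hex, Nat.find_spec hex, Nat.find_min' hex (hr0 _ (by omega)),
      fun i hi => Nat.pos_of_ne_zero (Nat.find_min hex hi)⟩
  let L : List ℕ := (List.range k).map (fun i => r (i + 1))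
  have hL : ∀ i, L.getD i 0 = r (i + 1) := by
    intro i
    rcases Nat.lt_or_ge i k with h | h
    · rw [List.getD_eq_getElem _ _ (by simpa [L] using h)]
      simp [L]
    · rw [List.getD_eq_default _ _ (by simpa [L] using h)]
      have := anti (k+1) (i+1) (by omega) (by omega)
      omega
  have hsum : L.sum = n := by
    rw [← sum_getD L n (by simpa [L] using hkn)]
    simp only [hL]
    rw [← card_rows hm hr0, hc]
  have hpos : ∀ x ∈ L, 0 < x := by
    intro x hx
    simp only [L, List.mem_map, List.mem_range] at hx
    obtain ⟨i, hi, rfl⟩ := hx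
    exact hkmin i hi
  have hsort : L.Pairwise (· ≥ ·) := by
    rw [List.pairwise_iff_getElem]
    intro i j hi hj hij
    simp only [L, List.getElem_map, List.getElem_range]
    exact anti _ _ (by omega) (by omega)
  let p : Nat.Partition n := ⟨(L : Multiset ℕ), fun {i} hi => hpos i hi, by simpa using hsum⟩
  have hLp : rowList p = L := by
    have hperm : (rowList p).Perm L := by
      rw [← Multiset.coe_eq_coe, rowList_coe]
    exact hperm.eq_of_pairwise (fun a b _ _ h1 h2 => le_antisymm h2 h1) (rowList_sorted p) hsort
  refine ⟨p, ?_⟩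
  ext ⟨i, j⟩
  rw [mem_cells_rowFun, hm]
  constructor
  · rintro ⟨h1, h2, h3⟩
    rw [rowFun_eq, hLp, hL, Nat.sub_add_cancel h1] at h3
    exact ⟨h1, h2, h3⟩
  · rintro ⟨h1, h2, h3⟩
    rw [rowFun_eq, hLp, hL, Nat.sub_add_cancel h1]
    exact ⟨h1, h2, h3⟩

/-- `Σ_{λ ⊢ n} (f^λ)² = n!`. -/
theorem sum_syt_sq (n : ℕ) :
    ∑ p : Nat.Partition n, (sytCard (rowFun p) n) ^ 2 = Nat.factorial n := by
  rw [← sq_sum numSyt numSyt_empty numSyt_rec n]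
  exact Finset.sum_bij (fun p _ => cells (rowFun p) n) (fun p _ => cells_mem_YY p)
    (fun p _ q _ h => cells_inj p q h)
    (fun s hs => by
      obtain ⟨p, hp⟩ := cells_surj s hs
      exact ⟨p, mem_univ _, hp⟩)
    (fun p _ => rfl)
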